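/- arXiv:2111.08860 — 4 statements merged into one kernel-verified Lean document; each statement's English description precedes it below -/
import Mathlib

section
/- Let (M, d_M) be a compact metric space of diameter at most 2 and let 𝒪M be the open cone over M. Then the map f : 𝒪M → 𝒪M induced by (t,x) ↦ (t/2, x) is coarsely homotopic to the identity map of 𝒪M: there exists a subset Z = {(p, s) ∈ 𝒪M × ℝ : 0 ≤ s ≤ t_p} of 𝒪M × ℝ (a metric subspace for the sum metric) and a coarse map h : Z → 𝒪M such that (1) the assignment p ↦ t_p satisfies: for any R ≥ 0 there exists S ≥ 0 with |t_p − t_q| ≤ S whenever d(p,q) ≤ R; (2) h(p, 0) = p for all p; and (3) h(p, t_p) = f(p) for all p. -/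
/-- Let `M` be a compact metric space of diameter at most 2 and `𝒪M` the
open cone over `M` (encoded by a metric space `OM` with a surjection `q : ℝ≥0 × M → OM`
realizing the cone pseudodistance).  The map `F` induced by `(t,x) ↦ (t/2, x)` is coarsely
homotopic to the identity of `𝒪M`: there is a controlled function `p ↦ T p ≥ 0` and a map
`h` on `Z = {(p,s) : 0 ≤ s ≤ T p} ⊆ OM × ℝ` (with the sum metric) which is coarse (proper
and controlled) and satisfies `h(p,0) = p` and `h(p, T p) = F p`. -/
theorem stmt_4 {M : Type*} [MetricSpace M] [CompactSpace M]
    (hM : ∀ x y : M, dist x y ≤ 2)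
    {OM : Type*} [MetricSpace OM]
    (q : NNReal × M → OM) (hq : Function.Surjective q)
    (hdist : ∀ p p' : NNReal × M,
      dist (q p) (q p') =
        |(p.1 : ℝ) - (p'.1 : ℝ)| + min (p.1 : ℝ) (p'.1 : ℝ) * dist p.2 p'.2)
    (F : OM → OM) (hF : ∀ p : NNReal × M, F (q p) = q (p.1 / 2, p.2)) :
    ∃ (T : OM → ℝ) (h : OM × ℝ → OM),
      (∀ p : OM, 0 ≤ T p) ∧
      -- the assignment `p ↦ T p` is controlled
      (∀ R : ℝ, 0 ≤ R → ∃ S : ℝ, 0 ≤ S ∧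
        ∀ p p' : OM, dist p p' ≤ R → |T p - T p'| ≤ S) ∧
      -- `h` is proper on `Z = {(p,s) | 0 ≤ s ≤ T p}` for the sum metric
      (∀ B : Set OM, Bornology.IsBounded B →
        ∃ C : ℝ, ∀ z z' : OM × ℝ,
          0 ≤ z.2 → z.2 ≤ T z.1 → 0 ≤ z'.2 → z'.2 ≤ T z'.1 →
          h z ∈ B → h z' ∈ B → dist z.1 z'.1 + |z.2 - z'.2| ≤ C) ∧
      -- `h` is controlled on `Z` for the sum metric
      (∀ R : ℝ, 0 ≤ R → ∃ S : ℝ, 0 ≤ S ∧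
        ∀ z z' : OM × ℝ,
          0 ≤ z.2 → z.2 ≤ T z.1 → 0 ≤ z'.2 → z'.2 ≤ T z'.1 →
          dist z.1 z'.1 + |z.2 - z'.2| ≤ R → dist (h z) (h z') ≤ S) ∧
      (∀ p : OM, h (p, 0) = p) ∧
      (∀ p : OM, h (p, T p) = F p) := by
  obtain ⟨σ, hσ⟩ := hq.hasRightInverse
  have hd (p p' : OM) : dist p p' = |((σ p).1 : ℝ) - ((σ p').1 : ℝ)|
      + min ((σ p).1 : ℝ) ((σ p').1 : ℝ) * dist (σ p).2 (σ p').2 := by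
    rw [← hdist, hσ, hσ]
  have hmin (p p' : OM) :
      0 ≤ min ((σ p).1 : ℝ) ((σ p').1 : ℝ) * dist (σ p).2 (σ p').2 := by positivity
  have hsub (p : OM) (s : ℝ) (hs : 0 ≤ s) (hsT : s ≤ ((σ p).1 : ℝ) / 2) :
      (((σ p).1 - s.toNNReal : NNReal) : ℝ) = (σ p).1 - s := by
    rw [NNReal.coe_sub, Real.coe_toNNReal s hs]
    exact Real.toNNReal_le_iff_le_coe.2 (by linarith [(σ p).1.coe_nonneg])
  refine ⟨fun p => ((σ p).1 : ℝ) / 2,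
    fun z => q ((σ z.1).1 - z.2.toNNReal, (σ z.1).2),
    fun p => by positivity, fun R hR => ⟨R, hR, fun p p' h => ?_⟩, fun B hB => ?_,
    fun R hR => ⟨R, hR, ?_⟩, fun p => ?_, fun p => ?_⟩
  · have h1 := hd p p'
    have h2 := hmin p p'
    have h3 : |((σ p).1 : ℝ) / 2 - ((σ p').1 : ℝ) / 2|
        = |((σ p).1 : ℝ) - ((σ p').1 : ℝ)| / 2 := by
      rw [← sub_div, abs_div, abs_two]
    rw [h3]
    linarith [abs_nonneg (((σ p).1 : ℝ) - ((σ p').1 : ℝ))]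
  · rcases isEmpty_or_nonempty M with hE | ⟨⟨x₀⟩⟩
    · exact ⟨0, fun z => hE.elim (σ z.1).2⟩
    obtain ⟨r, hr⟩ := hB.subset_closedBall (q (0, x₀))
    have key (z : OM × ℝ) (h0 : 0 ≤ z.2) (hT : z.2 ≤ ((σ z.1).1 : ℝ) / 2)
        (hz : q ((σ z.1).1 - z.2.toNNReal, (σ z.1).2) ∈ B) : ((σ z.1).1 : ℝ) ≤ 2 * r := by
      have h1 := Metric.mem_closedBall.1 (hr hz)
      rw [hdist] at h1
      simp only [hsub z.1 z.2 h0 hT, NNReal.coe_zero, sub_zero] at h1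
      have ht := (σ z.1).1.coe_nonneg
      rw [min_eq_right (by linarith), zero_mul, add_zero] at h1
      linarith [le_abs_self (((σ z.1).1 : ℝ) - z.2)]
    refine ⟨7 * r, fun z z' h0 hT h0' hT' hz hz' => ?_⟩
    have k := key z h0 hT hz
    have k' := key z' h0' hT' hz'
    have ht := (σ z.1).1.coe_nonneg
    have ht' := (σ z'.1).1.coe_nonneg
    have h1 : |((σ z.1).1 : ℝ) - (σ z'.1).1| ≤ 2 * r := abs_le.2 ⟨by linarith, by linarith⟩
    have h2 : |z.2 - z'.2| ≤ r := abs_le.2 ⟨by linarith, by linarith⟩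
    have h3 : min ((σ z.1).1 : ℝ) (σ z'.1).1 * dist (σ z.1).2 (σ z'.1).2 ≤ 2 * r * 2 :=
      mul_le_mul ((min_le_left _ _).trans k) (hM _ _) dist_nonneg (by linarith)
    rw [hd]
    linarith
  · intro z z' h0 hT h0' hT' h
    refine le_trans ?_ h
    rw [hdist, hd]
    simp only [hsub z.1 z.2 h0 hT, hsub z'.1 z'.2 h0' hT']
    have h1 : |((σ z.1).1 : ℝ) - z.2 - ((σ z'.1).1 - z'.2)|
        ≤ |((σ z.1).1 : ℝ) - (σ z'.1).1| + |z.2 - z'.2| := by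
      rw [sub_sub_sub_comm]
      exact abs_sub _ _
    have h2 : min (((σ z.1).1 : ℝ) - z.2) ((σ z'.1).1 - z'.2) * dist (σ z.1).2 (σ z'.1).2
        ≤ min ((σ z.1).1 : ℝ) (σ z'.1).1 * dist (σ z.1).2 (σ z'.1).2 := by
      gcongr <;> linarith
    linarith
  · simp [hσ p]
  · conv_rhs => rw [← hσ p, hF]
    dsimp only
    congr 2
    apply NNReal.eq
    rw [hsub p _ (by positivity) le_rfl]
    push_cast
    ring
end

section
/- Let (M, d_M) be a compact metric space of diameter at most 2 and let 𝒪M be the open cone over M. Then 𝒪M is scaleable: there exists a continuous proper map f : 𝒪M → 𝒪M which is coarsely homotopic to the identity map and satisfies d(f(p), f(q)) ≤ (1/2)·d(p,q) for all p, q ∈ 𝒪M. -/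
/-- Let `M` be a compact metric space of diameter at most 2 and `𝒪M` the
open cone over `M` (encoded by a metric space `OM` with a surjection `q : ℝ≥0 × M → OM`
realizing the cone pseudodistance).  Then `𝒪M` is scaleable: there is a continuous proper
map `F : OM → OM`, coarsely homotopic to the identity, with
`d(F p, F p') ≤ (1/2) d(p, p')` for all `p, p'`. -/
theorem stmt_5 {M : Type*} [MetricSpace M] [CompactSpace M]
    (hM : ∀ x y : M, dist x y ≤ 2)
    {OM : Type*} [MetricSpace OM]
    (q : NNReal × M → OM) (hq : Function.Surjective q)
    (hdist : ∀ p p' : NNReal × M,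
      dist (q p) (q p') =
        |(p.1 : ℝ) - (p'.1 : ℝ)| + min (p.1 : ℝ) (p'.1 : ℝ) * dist p.2 p'.2) :
    ∃ F : OM → OM,
      Continuous F ∧
      (∀ B : Set OM, Bornology.IsBounded B → Bornology.IsBounded (F ⁻¹' B)) ∧
      (∀ p p' : OM, dist (F p) (F p') ≤ (1 / 2) * dist p p') ∧
      -- `F` is coarsely homotopic to the identity map
      ∃ (T : OM → ℝ) (h : OM × ℝ → OM),
        (∀ p : OM, 0 ≤ T p) ∧
        (∀ R : ℝ, 0 ≤ R → ∃ S : ℝ, 0 ≤ S ∧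
          ∀ p p' : OM, dist p p' ≤ R → |T p - T p'| ≤ S) ∧
        (∀ B : Set OM, Bornology.IsBounded B →
          ∃ C : ℝ, ∀ z z' : OM × ℝ,
            0 ≤ z.2 → z.2 ≤ T z.1 → 0 ≤ z'.2 → z'.2 ≤ T z'.1 →
            h z ∈ B → h z' ∈ B → dist z.1 z'.1 + |z.2 - z'.2| ≤ C) ∧
        (∀ R : ℝ, 0 ≤ R → ∃ S : ℝ, 0 ≤ S ∧
          ∀ z z' : OM × ℝ,
            0 ≤ z.2 → z.2 ≤ T z.1 → 0 ≤ z'.2 → z'.2 ≤ T z'.1 →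
            dist z.1 z'.1 + |z.2 - z'.2| ≤ R → dist (h z) (h z') ≤ S) ∧
        (∀ p : OM, h (p, 0) = p) ∧
        (∀ p : OM, h (p, T p) = F p) := by
  obtain ⟨s, hs⟩ := hq.hasRightInverse
  obtain ⟨r, hr⟩ : ∃ r : OM → ℝ, ∀ p, r p = ((s p).1 : ℝ) := ⟨_, fun _ => rfl⟩
  have r_nonneg : ∀ p, 0 ≤ r p := fun p => by rw [hr]; exact NNReal.coe_nonneg _
  have dist_eq : ∀ p p' : OM,
      dist p p' = |r p - r p'| + min (r p) (r p') * dist (s p).2 (s p').2 := fun p p' => by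
    have := hdist (s p) (s p')
    rwa [hs, hs, ← hr, ← hr] at this
  -- The homotopy moves each point towards the apex at unit speed.
  obtain ⟨h, hh⟩ : ∃ h : OM × ℝ → OM,
      ∀ z, h z = q ((r z.1 - z.2).toNNReal, (s z.1).2) := ⟨_, fun _ => rfl⟩
  have dist_h : ∀ z z' : OM × ℝ, z.2 ≤ r z.1 / 2 → z'.2 ≤ r z'.1 / 2 →
      dist (h z) (h z') = |(r z.1 - z.2) - (r z'.1 - z'.2)|
        + min (r z.1 - z.2) (r z'.1 - z'.2) * dist (s z.1).2 (s z'.1).2 := by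
    intro z z' hz hz'
    have h1 := r_nonneg z.1
    have h2 := r_nonneg z'.1
    rw [hh, hh, hdist, Real.coe_toNNReal _ (by linarith), Real.coe_toNNReal _ (by linarith)]
  have r_lipschitz : ∀ p p', |r p - r p'| ≤ dist p p' := fun p p' => by
    rw [dist_eq]
    exact le_add_of_nonneg_right (mul_nonneg (le_min (r_nonneg p) (r_nonneg p')) dist_nonneg)
  have h_lipschitz : ∀ z z' : OM × ℝ, 0 ≤ z.2 → z.2 ≤ r z.1 / 2 → 0 ≤ z'.2 → z'.2 ≤ r z'.1 / 2 →
      dist (h z) (h z') ≤ dist z.1 z'.1 + |z.2 - z'.2| := by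
    intro z z' h0 h1 h0' h1'
    rw [dist_h z z' h1 h1', dist_eq z.1 z'.1]
    have hmin : min (r z.1 - z.2) (r z'.1 - z'.2) * dist (s z.1).2 (s z'.1).2
        ≤ min (r z.1) (r z'.1) * dist (s z.1).2 (s z'.1).2 := by
      gcongr <;> linarith
    have habs : |(r z.1 - z.2) - (r z'.1 - z'.2)| ≤ |r z.1 - r z'.1| + |z.2 - z'.2| := by
      rw [sub_sub_sub_comm]
      exact abs_sub _ _
    linarith
  have h_proper : ∀ B : Set OM, Bornology.IsBounded B → ∃ C : ℝ, ∀ z z' : OM × ℝ,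
      0 ≤ z.2 → z.2 ≤ r z.1 / 2 → 0 ≤ z'.2 → z'.2 ≤ r z'.1 / 2 →
      h z ∈ B → h z' ∈ B → dist z.1 z'.1 + |z.2 - z'.2| ≤ C := by
    intro B hB
    rcases B.eq_empty_or_nonempty with rfl | ⟨b, hb⟩
    · exact ⟨0, fun z z' _ _ _ _ hz => hz.elim⟩
    obtain ⟨K, hK⟩ := Metric.isBounded_iff.1 hB
    have radius_le : ∀ z : OM × ℝ, z.2 ≤ r z.1 / 2 → h z ∈ B → r z.1 ≤ 2 * (K + r b) := by
      intro z hz hzB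
      have hb0 : h (b, 0) = b := by
        rw [hh]
        simp [hr, hs b]
      have hd := dist_h z (b, 0) hz (div_nonneg (r_nonneg b) zero_le_two)
      rw [hb0] at hd
      have hr0 := r_nonneg z.1
      have hmin : 0 ≤ min (r z.1 - z.2) (r b - 0) * dist (s z.1).2 (s b).2 :=
        mul_nonneg (le_min (by linarith) (by linarith [r_nonneg b])) dist_nonneg
      have := hK hzB hb
      have := le_abs_self ((r z.1 - z.2) - (r b - 0))
      dsimp only at hd
      linarith
    refine ⟨4 * (2 * (K + r b)), fun z z' h0 h1 h0' h1' hz hz' => ?_⟩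
    have hrz := radius_le z h1 hz
    have hrz' := radius_le z' h1' hz'
    have hnz := r_nonneg z.1
    have hnz' := r_nonneg z'.1
    have hd : |r z.1 - r z'.1| ≤ 2 * (K + r b) := abs_le.2 ⟨by linarith, by linarith⟩
    have ht : |z.2 - z'.2| ≤ 2 * (K + r b) := abs_le.2 ⟨by linarith, by linarith⟩
    have hmin : min (r z.1) (r z'.1) * dist (s z.1).2 (s z'.1).2 ≤ 2 * (K + r b) * 2 :=
      mul_le_mul ((min_le_left _ _).trans hrz) (hM _ _) dist_nonneg (by linarith)
    rw [dist_eq]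
    linarith
  have half_nonneg : ∀ p, 0 ≤ r p / 2 := fun p => div_nonneg (r_nonneg p) zero_le_two
  have contraction : ∀ p p' : OM,
      dist (h (p, r p / 2)) (h (p', r p' / 2)) ≤ (1 / 2) * dist p p' := by
    intro p p'
    rw [dist_h _ _ le_rfl le_rfl, dist_eq p p']
    dsimp only
    rw [sub_half, sub_half, ← sub_div, abs_div, abs_two, min_div_div_right zero_le_two]
    apply le_of_eq
    ring
  refine ⟨fun p => h (p, r p / 2), ?_, ?_, contraction, fun p => r p / 2, h, half_nonneg,
    ?_, h_proper, ?_, ?_, fun _ => rfl⟩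
  · exact (LipschitzWith.of_dist_le_mul (K := 1 / 2) fun p p' => by
      simpa using contraction p p').continuous
  · intro B hB
    obtain ⟨C, hC⟩ := h_proper B hB
    refine Metric.isBounded_iff.2 ⟨C, fun p hp p' hp' => ?_⟩
    have := hC (p, r p / 2) (p', r p' / 2) (half_nonneg p) le_rfl (half_nonneg p') le_rfl hp hp'
    exact (le_add_of_nonneg_right (abs_nonneg _)).trans this
  · refine fun R hR => ⟨R, hR, fun p p' hp => ?_⟩
    rw [← sub_div, abs_div, abs_two]
    linarith [r_lipschitz p p', abs_nonneg (r p - r p')]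
  · exact fun R hR => ⟨R, hR, fun z z' h0 h1 h0' h1' hz =>
      (h_lipschitz z z' h0 h1 h0' h1').trans hz⟩
  · intro p
    rw [hh]
    simp [hr, hs p]
end

section
/- Let (M, d_M) be a compact metric space of diameter at most 2 with a countable dense subset Z_M, let d((t,x),(s,y)) = |t − s| + min{t,s}·d_M(x,y) on ℝ≥0 × M, and let D = ℚ≥0 × Z_M. Let p ∈ [1,∞), let σ be the bijection of D × ℕ given by σ(t, x, n) = (t/2, x, n), and let V be the induced surjective linear isometry of ℓ^p(D × ℕ) defined by (Vξ)(w) = ξ(σ⁻¹(w)), with inverse V⁺ = V⁻¹ induced by σ⁻¹. Then for every bounded linear operator T on ℓ^p(D × ℕ), every R ≥ 0 and every k ≥ 1: if (T δ_w)(w') = 0 for all w = (z, n), w' = (z', n') in D × ℕ with d(z, z') > R (where δ_w is the standard basis vector at w), then (V^k T (V⁺)^k δ_w)(w') = 0 for all w = (z, n), w' = (z', n') with d(z, z') > R / 2^k. In other words, conjugation by V^k divides the propagation of T by 2^k. -/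
open scoped ENNReal Classical

namespace lp

variable {α : Type*} {p : ℝ≥0∞} [Fact (1 ≤ p)]

/-- Powers of a composition operator are composition with the iterates. -/
theorem pow_apply_of_comp (A : lp (fun _ : α => ℂ) p →L[ℂ] lp (fun _ : α => ℂ) p)
    (f : α → α) (hA : ∀ (ξ : lp (fun _ : α => ℂ) p) (w : α), A ξ w = ξ (f w))
    (k : ℕ) (ξ : lp (fun _ : α => ℂ) p) (w : α) :
    (A ^ k) ξ w = ξ (f^[k] w) := by
  induction k generalizing ξ with
  | zero => rfl
  | succ k ih =>
    rw [pow_succ, mul_apply_eq_comp, ih, hA, Function.iterate_succ_apply']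

/-- Powers of the composition operator of a bijection move basis vectors along the iterates of
the inverse. -/
theorem pow_single_of_comp [DecidableEq α]
    (A : lp (fun _ : α => ℂ) p →L[ℂ] lp (fun _ : α => ℂ) p)
    (σ : α ≃ α) (hA : ∀ (ξ : lp (fun _ : α => ℂ) p) (w : α), A ξ w = ξ (σ w))
    (k : ℕ) (w : α) (c : ℂ) :
    (A ^ k) (lp.single p w c) = lp.single p (σ.symm^[k] w) c := by
  induction k generalizing w with
  | zero => rfl
  | succ k ih =>
    have hone : A (lp.single p w c) = lp.single p (σ.symm w) c := by
      ext v
      rw [hA, lp.single_apply, lp.single_apply]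
      simp only [Pi.single_apply, Equiv.eq_symm_apply]
    rw [pow_succ, mul_apply_eq_comp, hone, ih, Function.iterate_succ_apply]

end lp

/-- The iterates of the inverse of the halving map. -/
theorem iterate_symm_of_half {X : Type*} (σ : ((ℚ≥0 × X) × ℕ) ≃ ((ℚ≥0 × X) × ℕ))
    (hσ : ∀ (t : ℚ≥0) (x : X) (n : ℕ), σ ((t, x), n) = ((t / 2, x), n))
    (k : ℕ) (t : ℚ≥0) (x : X) (n : ℕ) :
    σ.symm^[k] ((t, x), n) = ((2 ^ k * t, x), n) := by
  induction k with
  | zero => simp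
  | succ k ih =>
    rw [Function.iterate_succ_apply', ih, Equiv.symm_apply_eq, hσ, pow_succ, mul_right_comm,
      mul_div_cancel_right₀ _ two_ne_zero]

/-- Let `M` be a compact metric space of diameter at most 2 with a
countable dense subset `Z_M`, let `cd` denote the cone pseudodistance
`cd((t,x),(s,y)) = |t − s| + min t s * d_M(x,y)` restricted to `D = ℚ≥0 × Z_M`, and let
`p ∈ [1,∞)`.  Let `σ` be the bijection of `D × ℕ` given by `σ(t,x,n) = (t/2,x,n)`, `V` the
induced surjective linear isometry of `ℓ^p(D × ℕ)`, `(Vξ)(w) = ξ(σ⁻¹ w)`, and `V⁺ = V⁻¹`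
induced by `σ⁻¹`.  If a bounded operator `T` on `ℓ^p(D × ℕ)` has propagation at most `R`
(its matrix entries vanish whenever `cd z z' > R`), then `V^k T (V⁺)^k` has propagation at
most `R / 2^k`. -/
theorem stmt_8 {M : Type*} [MetricSpace M] [CompactSpace M]
    (hM : ∀ x y : M, dist x y ≤ 2)
    (ZM : Set M) (hZMc : ZM.Countable) (hZMd : Dense ZM)
    (cd : (ℚ≥0 × ZM) → (ℚ≥0 × ZM) → ℝ)
    (hcd : ∀ z z' : ℚ≥0 × ZM,
      cd z z' = |(z.1 : ℝ) - (z'.1 : ℝ)| +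
        min (z.1 : ℝ) (z'.1 : ℝ) * dist (z.2 : M) (z'.2 : M))
    (p : ℝ≥0∞) [Fact (1 ≤ p)] (hp : p ≠ ∞)
    (σ : ((ℚ≥0 × ZM) × ℕ) ≃ ((ℚ≥0 × ZM) × ℕ))
    (hσ : ∀ (t : ℚ≥0) (x : ZM) (n : ℕ), σ ((t, x), n) = ((t / 2, x), n))
    (V Vp : lp (fun _ : (ℚ≥0 × ZM) × ℕ => ℂ) p →L[ℂ] lp (fun _ : (ℚ≥0 × ZM) × ℕ => ℂ) p)
    (hV : ∀ (ξ : lp (fun _ : (ℚ≥0 × ZM) × ℕ => ℂ) p) (w : (ℚ≥0 × ZM) × ℕ),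
      V ξ w = ξ (σ.symm w))
    (hVp : ∀ (ξ : lp (fun _ : (ℚ≥0 × ZM) × ℕ => ℂ) p) (w : (ℚ≥0 × ZM) × ℕ),
      Vp ξ w = ξ (σ w))
    (T : lp (fun _ : (ℚ≥0 × ZM) × ℕ => ℂ) p →L[ℂ] lp (fun _ : (ℚ≥0 × ZM) × ℕ => ℂ) p)
    (R : ℝ) (hR : 0 ≤ R) (k : ℕ) (hk : 1 ≤ k)
    (hT : ∀ (z z' : ℚ≥0 × ZM) (n n' : ℕ), R < cd z z' →
      T (lp.single p (z, n) 1) (z', n') = 0) :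
    ∀ (z z' : ℚ≥0 × ZM) (n n' : ℕ), R / 2 ^ k < cd z z' →
      (V ^ k) (T ((Vp ^ k) (lp.single p (z, n) 1))) (z', n') = 0 := by
  rintro ⟨t, x⟩ ⟨s, y⟩ n n' h
  rw [lp.pow_apply_of_comp V σ.symm hV, lp.pow_single_of_comp Vp σ hVp,
    iterate_symm_of_half σ hσ, iterate_symm_of_half σ hσ]
  apply hT
  have hscale : cd (2 ^ k * t, x) (2 ^ k * s, y) = cd (t, x) (s, y) * 2 ^ k := by
    have h2 : (0 : ℝ) ≤ 2 ^ k := by positivity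
    simp only [hcd]
    push_cast
    rw [← mul_sub, abs_mul, abs_of_nonneg h2, ← mul_min_of_nonneg _ _ h2]
    ring
  rw [hscale]
  exact (div_lt_iff₀ (by positivity)).mp h
end

section
/- Let X and Y be proper metric spaces with countable dense subsets Z_X ⊆ X and Z_Y ⊆ Y, let f : X → Y be a coarse map, let ε > 0 and p ∈ [1,∞). Then there exists an injection σ : Z_X × ℕ → Z_Y × ℕ such that whenever σ(z, n) = (y, m) one has d(f(z), y) ≤ ε. Consequently: (1) the linear operator V : ℓ^p(Z_X × ℕ) → ℓ^p(Z_Y × ℕ) defined by (Vξ)(w) = ξ(σ⁻¹(w)) for w in the range of σ and (Vξ)(w) = 0 otherwise is an isometry; (2) the linear operator V⁺ : ℓ^p(Z_Y × ℕ) → ℓ^p(Z_X × ℕ) defined by (V⁺η)(v) = η(σ(v)) is contractive (norm at most 1) and satisfies V⁺ ∘ V = id; and (3) the supports are ε-close to the graph of f: (V δ_{(z,n)})(y, m) = 0 whenever d(f(z), y) > ε, and (V⁺ δ_{(y,m)})(z, n) = 0 whenever d(f(z), y) > ε. -/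
open scoped ENNReal Classical

namespace lp

variable {𝕜 E α β : Type*} [NormedField 𝕜] [NormedAddCommGroup E] [NormedSpace 𝕜 E]
  {p : ℝ≥0∞} {σ : α → β}

theorem hasSum_norm_rpow_extend_zero (hp : 0 < p.toReal) (hσ : Function.Injective σ)
    (ξ : lp (fun _ : α => E) p) :
    HasSum (fun w => ‖Function.extend σ ξ 0 w‖ ^ p.toReal) (‖ξ‖ ^ p.toReal) := by
  refine (hσ.hasSum_iff fun w hw => ?_).mp ?_
  · rw [Function.extend_apply' _ _ _ (by simpa using hw)]
    simp [Real.zero_rpow hp.ne']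
  · simpa only [Function.comp_def, hσ.extend_apply] using lp.hasSum_norm hp ξ

variable (𝕜 E) in
/-- Extension by zero along an injection, as a linear isometry of `ℓ^p` spaces. -/
noncomputable def extendByZero [Fact (1 ≤ p)] (hp : p ≠ ∞) (hσ : Function.Injective σ) :
    lp (fun _ : α => E) p →ₗᵢ[𝕜] lp (fun _ : β => E) p :=
  have hp₀ : 0 < p.toReal := ENNReal.toReal_pos (zero_lt_one.trans_le Fact.out).ne' hp
  { toFun := fun ξ => ⟨Function.extend σ ξ 0,
      memℓp_gen (hasSum_norm_rpow_extend_zero hp₀ hσ ξ).summable⟩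
    map_add' := fun ξ η => lp.ext <| by
      have h := Function.extend_add σ (ξ : α → E) η (0 : β → E) 0
      rw [add_zero] at h
      exact h
    map_smul' := fun c ξ => lp.ext <| by
      simpa using Function.extend_smul c σ ξ 0
    norm_map' := fun ξ => by
      refine (Real.rpow_left_inj (norm_nonneg _) (norm_nonneg _) hp₀.ne').mp ?_
      exact (lp.hasSum_norm hp₀ _).unique (hasSum_norm_rpow_extend_zero hp₀ hσ ξ) }

theorem extendByZero_apply [Fact (1 ≤ p)] (hp : p ≠ ∞) (hσ : Function.Injective σ)
    (ξ : lp (fun _ : α => E) p) (v : α) : extendByZero 𝕜 E hp hσ ξ (σ v) = ξ v :=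
  hσ.extend_apply _ _ _

theorem extendByZero_apply_of_notMem_range [Fact (1 ≤ p)] (hp : p ≠ ∞)
    (hσ : Function.Injective σ) (ξ : lp (fun _ : α => E) p) {w : β} (hw : w ∉ Set.range σ) :
    extendByZero 𝕜 E hp hσ ξ w = 0 :=
  Function.extend_apply' _ _ _ hw

theorem summable_norm_rpow_comp (hp : 0 < p.toReal) (hσ : Function.Injective σ)
    (η : lp (fun _ : β => E) p) : Summable fun v => ‖η (σ v)‖ ^ p.toReal :=
  ((lp.memℓp η).summable hp).comp_injective hσ

variable (𝕜 E) in
/-- Composition with an injection, as a linear map of `ℓ^p` spaces. -/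
def compInjectiveₗ (hp : 0 < p.toReal) (hσ : Function.Injective σ) :
    lp (fun _ : β => E) p →ₗ[𝕜] lp (fun _ : α => E) p where
  toFun η := ⟨fun v => η (σ v), memℓp_gen (summable_norm_rpow_comp hp hσ η)⟩
  map_add' _ _ := rfl
  map_smul' _ _ := rfl

@[simp]
theorem compInjectiveₗ_apply (hp : 0 < p.toReal) (hσ : Function.Injective σ)
    (η : lp (fun _ : β => E) p) (v : α) : compInjectiveₗ 𝕜 E hp hσ η v = η (σ v) :=
  rfl

theorem norm_compInjectiveₗ_le (hp : 0 < p.toReal) (hσ : Function.Injective σ)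
    (η : lp (fun _ : β => E) p) : ‖compInjectiveₗ 𝕜 E hp hσ η‖ ≤ ‖η‖ := by
  refine lp.norm_le_of_tsum_le hp (lp.norm_nonneg' η) ?_
  rw [lp.norm_rpow_eq_tsum hp η]
  exact (summable_norm_rpow_comp hp hσ η).tsum_le_tsum_of_inj σ hσ
    (fun _ _ => Real.rpow_nonneg (norm_nonneg _) _) (fun _ => le_rfl)
    ((lp.memℓp η).summable hp)

end lp

/-- For a countable type `S`, any map from `S` to a metric space is approximated by the first
coordinate of an injection `S × ℕ → D × ℕ`, where `D` is a dense subset. -/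
theorem Dense.exists_injective_prod_nat_dist_le {S Y : Type*} [Countable S]
    [PseudoMetricSpace Y] {D : Set Y} (hD : Dense D) (g : S → Y) {ε : ℝ} (hε : 0 < ε) :
    ∃ σ : S × ℕ → D × ℕ, Function.Injective σ ∧ ∀ v, dist (g v.1) (σ v).1 ≤ ε := by
  choose y hyD hy using fun s => hD.exists_dist_lt (g s) hε
  obtain ⟨e, he⟩ := exists_injective_nat (S × ℕ)
  exact ⟨fun v => (⟨y v.1, hyD v.1⟩, e v), fun _ _ h => he (congrArg Prod.snd h),
    fun v => (hy v.1).le⟩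

/-- Let `X`, `Y` be proper metric spaces with countable dense subsets
`Z_X`, `Z_Y`, let `f : X → Y` be a coarse map (proper and controlled), `ε > 0` and
`p ∈ [1,∞)`.  Then there is an injection `σ : Z_X × ℕ → Z_Y × ℕ` with
`d(f z, y) ≤ ε` whenever `σ(z,n) = (y,m)`, and the associated operators
`V : ℓ^p(Z_X × ℕ) → ℓ^p(Z_Y × ℕ)`, `(Vξ)(w) = ξ(σ⁻¹ w)` on the range of `σ` and `0`
elsewhere, and `V⁺ : ℓ^p(Z_Y × ℕ) → ℓ^p(Z_X × ℕ)`, `(V⁺η)(v) = η(σ v)`, satisfy: `V` is an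
isometry, `V⁺` is contractive with `V⁺ ∘ V = id`, and the supports of `V`, `V⁺` are
`ε`-close to the graph of `f`. -/
theorem stmt_9 {X Y : Type*} [MetricSpace X] [ProperSpace X] [MetricSpace Y] [ProperSpace Y]
    (ZX : Set X) (hZXc : ZX.Countable) (hZXd : Dense ZX)
    (ZY : Set Y) (hZYc : ZY.Countable) (hZYd : Dense ZY)
    (f : X → Y)
    (hfproper : ∀ B : Set Y, Bornology.IsBounded B → Bornology.IsBounded (f ⁻¹' B))
    (hfctrl : ∀ R : ℝ, 0 ≤ R → ∃ S : ℝ, 0 ≤ S ∧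
      ∀ x x' : X, dist x x' ≤ R → dist (f x) (f x') ≤ S)
    (ε : ℝ) (hε : 0 < ε)
    (p : ℝ≥0∞) [Fact (1 ≤ p)] (hp : p ≠ ∞) :
    ∃ σ : (ZX × ℕ) → (ZY × ℕ),
      Function.Injective σ ∧
      (∀ v : ZX × ℕ, dist (f (v.1 : X)) (((σ v).1 : Y)) ≤ ε) ∧
      ∃ (V : lp (fun _ : ZX × ℕ => ℂ) p →L[ℂ] lp (fun _ : ZY × ℕ => ℂ) p)
        (Vp : lp (fun _ : ZY × ℕ => ℂ) p →L[ℂ] lp (fun _ : ZX × ℕ => ℂ) p),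
        -- `V` is given by `(Vξ)(w) = ξ(σ⁻¹ w)` on the range of `σ`, `0` elsewhere,
        -- and is an isometry
        (∀ (ξ : lp (fun _ : ZX × ℕ => ℂ) p) (v : ZX × ℕ), V ξ (σ v) = ξ v) ∧
        (∀ (ξ : lp (fun _ : ZX × ℕ => ℂ) p) (w : ZY × ℕ), w ∉ Set.range σ → V ξ w = 0) ∧
        (∀ ξ : lp (fun _ : ZX × ℕ => ℂ) p, ‖V ξ‖ = ‖ξ‖) ∧
        -- `V⁺` is given by `(V⁺η)(v) = η(σ v)`, is contractive, and `V⁺ ∘ V = id`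
        (∀ (η : lp (fun _ : ZY × ℕ => ℂ) p) (v : ZX × ℕ), Vp η v = η (σ v)) ∧
        (∀ η : lp (fun _ : ZY × ℕ => ℂ) p, ‖Vp η‖ ≤ ‖η‖) ∧
        (∀ ξ : lp (fun _ : ZX × ℕ => ℂ) p, Vp (V ξ) = ξ) ∧
        -- the supports of `V` and `V⁺` are `ε`-close to the graph of `f`
        (∀ (z : ZX) (n : ℕ) (y : ZY) (m : ℕ), ε < dist (f (z : X)) ((y : Y)) →
          V (lp.single p (z, n) 1) (y, m) = 0) ∧
        (∀ (y : ZY) (m : ℕ) (z : ZX) (n : ℕ), ε < dist (f (z : X)) ((y : Y)) →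
          Vp (lp.single p (y, m) 1) (z, n) = 0) := by
  have hp₀ : 0 < p.toReal := ENNReal.toReal_pos (zero_lt_one.trans_le Fact.out).ne' hp
  have : Countable ZX := hZXc.to_subtype
  obtain ⟨σ, hσ, hdist⟩ :=
    hZYd.exists_injective_prod_nat_dist_le (fun z : ZX => f z) hε
  have hVp := lp.norm_compInjectiveₗ_le (𝕜 := ℂ) (E := ℂ) hp₀ hσ
  have hne {z : ZX} {n : ℕ} {y : ZY} {m : ℕ} (h : ε < dist (f z) (y : Y)) :
      σ (z, n) ≠ (y, m) := fun e =>
    h.not_ge (by simpa [e] using hdist (z, n))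
  refine ⟨σ, hσ, hdist, (lp.extendByZero ℂ ℂ hp hσ).toContinuousLinearMap,
    (lp.compInjectiveₗ ℂ ℂ hp₀ hσ).mkContinuous 1 (by simpa using hVp),
    lp.extendByZero_apply hp hσ, fun ξ w => lp.extendByZero_apply_of_notMem_range hp hσ ξ,
    (lp.extendByZero ℂ ℂ hp hσ).norm_map, fun _ _ => rfl, hVp,
    fun ξ => lp.ext <| funext <| lp.extendByZero_apply (𝕜 := ℂ) hp hσ ξ,
    fun z n y m h => ?_, fun y m z n h => lp.single_apply_ne p _ _ (hne h)⟩
  by_cases hw : (y, m) ∈ Set.range σ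
  · obtain ⟨v, hv⟩ := hw
    have hvz : v ≠ (z, n) := by
      rintro rfl
      exact hne h hv
    rw [← hv]
    exact (lp.extendByZero_apply hp hσ _ v).trans (lp.single_apply_ne p _ _ hvz)
  · exact lp.extendByZero_apply_of_notMem_range hp hσ _ hw
end
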